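/- Fix τ ∈ (0,π). Let {μ_{nk}} be an infinitesimal array of probability measures on 𝕋, each with nonzero first moment, let {λ_n}_{n≥1} ⊂ 𝕋, and let ν be a Borel probability measure on 𝕋. If λ_n · Π_{k=1}^{k_n} B_{μ_{nk}}(z) converges to B_ν(z) uniformly on compact subsets of 𝔻 as n → ∞ (equivalently, the boolean convolutions δ_{λ_n} ⨃ μ_{n1} ⨃ ⋯ ⨃ μ_{nk_n} converge weakly to ν), then B_ν is either identically zero on 𝔻 or has no zeros in 𝔻, i.e., ν is ⨃-infinitely divisible. -/

import Mathlib

open MeasureTheory Complex Filter Topology Metric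

noncomputable section

instance : MeasurableSpace Circle := borel Circle
instance : BorelSpace Circle := ⟨rfl⟩

/-- ψ_μ(z) = ∫ ζz/(1-ζz) dμ(ζ). -/
def psiT (μ : Measure Circle) (z : ℂ) : ℂ :=
  ∫ ζ : Circle, ((ζ : ℂ) * z) / (1 - (ζ : ℂ) * z) ∂μ

/-- The B-transform of a measure on the circle:
B_μ(z) = (1/z)·ψ_μ(z)/(1+ψ_μ(z)) for z ≠ 0 and B_μ(0) = ∫ ζ dμ. -/
def BT (μ : Measure Circle) (z : ℂ) : ℂ :=
  if z = 0 then ∫ ζ : Circle, (ζ : ℂ) ∂μ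
  else z⁻¹ * (psiT μ z / (1 + psiT μ z))

/-- Infinitesimal triangular array: max_{1≤k≤k_n} μ_{nk}{|ζ-1| ≥ ε} → 0 as n → ∞. -/
def IsInfinitesimalArrayT (kn : ℕ → ℕ) (μ : ℕ → ℕ → Measure Circle) : Prop :=
  ∀ ε : ℝ, 0 < ε → ∀ δ : ENNReal, 0 < δ → ∃ N : ℕ, ∀ n ≥ N, ∀ i < kn n,
    μ n i {ζ : Circle | ε ≤ ‖(ζ : ℂ) - 1‖} < δ

/-- β = ∫_{|arg ζ|<τ} arg ζ dμ. -/
def betaT (τ : ℝ) (μ : Measure Circle) : ℝ :=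
  ∫ ζ in {ζ : Circle | |Complex.arg (ζ : ℂ)| < τ}, Complex.arg (ζ : ℂ) ∂μ

/-- b = e^{iβ} as an element of the circle. -/
def bT (τ : ℝ) (μ : Measure Circle) : Circle := Circle.exp (betaT τ μ)

/-- μ° : the centering of μ, i.e. the pushforward of μ under ζ ↦ b⁻¹ ζ. -/
def centerT (τ : ℝ) (μ : Measure Circle) : Measure Circle :=
  Measure.map (fun ζ => (bT τ μ)⁻¹ * ζ) μ

/-- h(z) = -i ∫ Im ζ dμ° + ∫ (1+ζz)/(1-ζz)·(1-Re ζ) dμ°, for the centered measure μ°. -/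
def hT (τ : ℝ) (μ : Measure Circle) (z : ℂ) : ℂ :=
  -Complex.I * ((∫ ζ : Circle, ((ζ : ℂ)).im ∂(centerT τ μ) : ℝ) : ℂ) +
    ∫ ζ : Circle, ((1 + (ζ : ℂ) * z) / (1 - (ζ : ℂ) * z)) * ((1 - ((ζ : ℂ)).re : ℝ) : ℂ)
      ∂(centerT τ μ)

/-- Hurwitz's theorem: a locally uniform limit of holomorphic functions on a preconnected open set,
eventually zero-free on each compact subset, is identically zero or zero-free. -/
theorem hurwitz_eqOn_zero_or_forall_ne_zero {ι : Type*} {l : Filter ι} [l.NeBot] {U : Set ℂ}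
    {F : ι → ℂ → ℂ} {f : ℂ → ℂ} (hU : IsOpen U) (hU' : IsPreconnected U)
    (hF : ∀ n, DifferentiableOn ℂ (F n) U)
    (hne : ∀ K ⊆ U, IsCompact K → ∀ᶠ n in l, ∀ z ∈ K, F n z ≠ 0)
    (hlim : ∀ K ⊆ U, IsCompact K → TendstoUniformlyOn F f l K) :
    (∀ z ∈ U, f z = 0) ∨ (∀ z ∈ U, f z ≠ 0) := by
  have hdiff : DifferentiableOn ℂ f U :=
    ((tendstoLocallyUniformlyOn_iff_forall_isCompact hU).2 hlim).differentiableOn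
      (Eventually.of_forall hF) hU
  refine or_iff_not_imp_right.2 fun hzero => ?_
  push Not at hzero
  obtain ⟨z₀, hz₀, hfz₀⟩ := hzero
  by_contra hnot
  have hfreq : ¬ ∃ᶠ z in 𝓝[≠] z₀, f z = 0 := fun h => hnot
    ((hdiff.analyticOnNhd hU).eqOn_zero_of_preconnected_of_frequently_eq_zero hU' hz₀ h)
  rw [not_frequently, eventually_nhdsWithin_iff] at hfreq
  obtain ⟨r, hr, hball⟩ :=
    nhds_basis_closedBall.eventually_iff.1 (hfreq.and (hU.mem_nhds hz₀))
  have hKU : closedBall z₀ r ⊆ U := fun z hz => (hball hz).2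
  obtain ⟨w, hw, hmin⟩ := (isCompact_sphere z₀ r).exists_isMinOn
    (NormedSpace.sphere_nonempty.2 hr.le)
    ((hdiff.continuousOn.mono (sphere_subset_closedBall.trans hKU)).norm)
  have hm : 0 < ‖f w‖ := norm_pos_iff.2 <|
    (hball (sphere_subset_closedBall hw)).1 (ne_of_mem_sphere hw hr.ne')
  have hcpt := isCompact_closedBall z₀ r
  obtain ⟨n, hclose, hn⟩ := ((Metric.tendstoUniformlyOn_iff.1 (hlim _ hKU hcpt)
    (‖f w‖ / 2) (by positivity)).and (hne _ hKU hcpt)).exists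
  have hcl : closure (ball z₀ r) = closedBall z₀ r := closure_ball z₀ hr.ne'
  have hinv : DiffContOnCl ℂ (F n)⁻¹ (ball z₀ r) := by
    refine DiffContOnCl.inv ?_ fun z hz => hn z (hcl ▸ hz)
    exact DifferentiableOn.diffContOnCl (hcl ▸ (hF n).mono hKU)
  have hz₀K : z₀ ∈ closedBall z₀ r := mem_closedBall_self hr.le
  have hle : ‖(F n)⁻¹ z₀‖ ≤ (‖f w‖ / 2)⁻¹ := by
    refine Complex.norm_le_of_forall_mem_frontier_norm_le isBounded_ball hinv (fun z hz => ?_)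
      (hcl ▸ hz₀K)
    rw [frontier_ball z₀ hr.ne'] at hz
    have h1 := hclose z (sphere_subset_closedBall hz)
    have h2 : ‖f w‖ ≤ ‖f z‖ := hmin hz
    rw [dist_eq_norm] at h1
    have h3 := norm_sub_norm_le (f z) (F n z)
    rw [Pi.inv_apply, norm_inv]
    exact inv_anti₀ (by positivity) (by linarith)
  rw [Pi.inv_apply, norm_inv,
    inv_le_inv₀ (norm_pos_iff.2 (hn z₀ hz₀K)) (by positivity)] at hle
  have h1 := hclose z₀ hz₀K
  rw [hfz₀, dist_zero_left] at h1
  linarith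

theorem one_sub_norm_le_norm_one_sub_circle_mul (ζ : Circle) (z : ℂ) :
    1 - ‖z‖ ≤ ‖1 - (ζ : ℂ) * z‖ := by
  have h := norm_sub_norm_le 1 ((ζ : ℂ) * z)
  rwa [norm_one, norm_mul, Circle.norm_coe, one_mul] at h

theorem one_sub_circle_mul_ne_zero (ζ : Circle) {z : ℂ} (hz : z ∈ ball (0 : ℂ) 1) :
    1 - (ζ : ℂ) * z ≠ 0 := by
  rw [mem_ball_zero_iff] at hz
  exact norm_pos_iff.1 ((sub_pos.2 hz).trans_le (one_sub_norm_le_norm_one_sub_circle_mul ζ z))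

theorem integrable_of_continuous_circle (μ : Measure Circle) [IsFiniteMeasure μ] {g : Circle → ℂ}
    (hg : Continuous g) : Integrable g μ := by
  rw [← integrableOn_univ]
  exact hg.continuousOn.integrableOn_compact isCompact_univ

theorem continuous_div_one_sub_circle_mul {g : Circle → ℂ} (hg : Continuous g) {z : ℂ}
    (hz : z ∈ ball (0 : ℂ) 1) : Continuous fun ζ : Circle => g ζ / (1 - (ζ : ℂ) * z) :=
  hg.div (by fun_prop) fun ζ => one_sub_circle_mul_ne_zero ζ hz

theorem differentiableOn_integral_div_one_sub_circle_mul (μ : Measure Circle) [IsFiniteMeasure μ]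
    {g : Circle → ℂ} (hg : Continuous g) :
    DifferentiableOn ℂ (fun z => ∫ ζ : Circle, g ζ / (1 - (ζ : ℂ) * z) ∂μ) (ball 0 1) := by
  intro z₀ hz₀
  obtain ⟨r, hr, hr1⟩ := exists_between (mem_ball_zero_iff.1 hz₀)
  have hsub : ball (0 : ℂ) r ⊆ ball 0 1 := ball_subset_ball hr1.le
  have hderiv : ∀ ζ : Circle, ∀ z ∈ ball (0 : ℂ) r,
      HasDerivAt (fun z => g ζ / (1 - (ζ : ℂ) * z))
        (g ζ * ζ / (1 - (ζ : ℂ) * z) ^ 2) z := by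
    intro ζ z hz
    have h : HasDerivAt (fun z : ℂ => 1 - (ζ : ℂ) * z) (-(ζ : ℂ)) z := by
      simpa using ((hasDerivAt_id z).const_mul (ζ : ℂ)).const_sub 1
    exact ((hasDerivAt_const z (g ζ)).fun_div h
      (one_sub_circle_mul_ne_zero ζ (hsub hz))).congr_deriv (by ring)
  refine (hasDerivAt_integral_of_dominated_loc_of_deriv_le
    (F := fun z (ζ : Circle) => g ζ / (1 - (ζ : ℂ) * z))
    (F' := fun z (ζ : Circle) => g ζ * ζ / (1 - (ζ : ℂ) * z) ^ 2)
    (bound := fun ζ => ‖g ζ‖ / (1 - r) ^ 2)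
    (isOpen_ball.mem_nhds (mem_ball_zero_iff.2 hr)) ?_ ?_ ?_ ?_ ?_
    (Eventually.of_forall hderiv)).2.differentiableAt.differentiableWithinAt
  · filter_upwards [isOpen_ball.mem_nhds hz₀] with z hz
    exact (continuous_div_one_sub_circle_mul hg hz).aestronglyMeasurable
  · exact integrable_of_continuous_circle μ (continuous_div_one_sub_circle_mul hg hz₀)
  · refine Continuous.aestronglyMeasurable ?_
    exact (hg.mul (by fun_prop)).div (by fun_prop)
      fun ζ => pow_ne_zero 2 (one_sub_circle_mul_ne_zero ζ hz₀)
  · refine Eventually.of_forall fun ζ z hz => ?_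
    rw [mem_ball_zero_iff] at hz
    have h := one_sub_norm_le_norm_one_sub_circle_mul ζ z
    rw [norm_div, norm_mul, norm_pow, Circle.norm_coe, mul_one]
    have h0 : 0 < 1 - r := by linarith
    gcongr
    linarith
  · exact (integrable_of_continuous_circle μ hg).norm.div_const _

theorem integral_inv_one_sub_circle_mul_ne_zero (μ : Measure Circle) [IsProbabilityMeasure μ]
    {z : ℂ} (hz : z ∈ ball (0 : ℂ) 1) : ∫ ζ : Circle, 1 / (1 - (ζ : ℂ) * z) ∂μ ≠ 0 := by
  have hint := integrable_of_continuous_circle μ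
    (continuous_div_one_sub_circle_mul (g := fun _ => 1) continuous_const hz)
  have hre : (1 / 2 : ℝ) ≤ (∫ ζ : Circle, 1 / (1 - (ζ : ℂ) * z) ∂μ).re := by
    rw [← RCLike.re_eq_complex_re, ← integral_re hint]
    have hconst : ∫ _ : Circle, (1 / 2 : ℝ) ∂μ = 1 / 2 := by simp
    rw [← hconst]
    refine integral_mono (integrable_const _) hint.re fun ζ => ?_
    have hne := one_sub_circle_mul_ne_zero ζ hz
    have hlt : normSq ((ζ : ℂ) * z) < 1 := by
      rw [normSq_eq_norm_sq, norm_mul, Circle.norm_coe, one_mul]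
      rw [mem_ball_zero_iff] at hz
      nlinarith [norm_nonneg z]
    have hpos := normSq_pos.2 hne
    generalize (ζ : ℂ) * z = w at *
    simp only [RCLike.re_eq_complex_re, one_div, inv_re]
    rw [inv_le_comm₀ (by norm_num) (by
      refine div_pos ?_ hpos
      rw [normSq_apply] at hlt
      simp only [sub_re, one_re]
      nlinarith [mul_self_nonneg w.im]), inv_div]
    rw [normSq_apply] at *
    simp only [sub_re, one_re, sub_im, one_im] at *
    rw [div_le_iff₀ (by nlinarith [mul_self_nonneg w.im])]
    nlinarith
  intro h
  rw [h] at hre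
  norm_num at hre

theorem BT_eq_div (μ : Measure Circle) [IsProbabilityMeasure μ] {z : ℂ}
    (hz : z ∈ ball (0 : ℂ) 1) :
    BT μ z = (∫ ζ : Circle, (ζ : ℂ) / (1 - (ζ : ℂ) * z) ∂μ) /
      ∫ ζ : Circle, 1 / (1 - (ζ : ℂ) * z) ∂μ := by
  by_cases h0 : z = 0
  · simp [BT, h0]
  have hpsi : psiT μ z = z * ∫ ζ : Circle, (ζ : ℂ) / (1 - (ζ : ℂ) * z) ∂μ := by
    rw [psiT, ← integral_const_mul]
    congr 1 with ζ
    ring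
  have hone : 1 + psiT μ z = ∫ ζ : Circle, 1 / (1 - (ζ : ℂ) * z) ∂μ := by
    have hint := integrable_of_continuous_circle μ (continuous_div_one_sub_circle_mul
      (g := fun ζ => (ζ : ℂ) * z) (by fun_prop) hz)
    have h1 : ∫ _ : Circle, (1 : ℂ) ∂μ = 1 := by simp
    rw [psiT]
    conv_lhs => enter [1]; rw [← h1]
    rw [← integral_add (integrable_const _) hint]
    congr 1 with ζ
    have hne := one_sub_circle_mul_ne_zero ζ hz
    field_simp
    ring
  rw [BT, if_neg h0, hone, hpsi]
  field_simp

theorem differentiableOn_BT (μ : Measure Circle) [IsProbabilityMeasure μ] :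
    DifferentiableOn ℂ (BT μ) (ball 0 1) :=
  ((differentiableOn_integral_div_one_sub_circle_mul μ (g := fun ζ => (ζ : ℂ)) (by fun_prop)).div
    (differentiableOn_integral_div_one_sub_circle_mul μ continuous_const)
    fun _ hz => integral_inv_one_sub_circle_mul_ne_zero μ hz).congr fun _ hz => BT_eq_div μ hz

theorem integral_norm_circle_sub_one_le (μ : Measure Circle) [IsProbabilityMeasure μ] (ε : ℝ)
    (hε : 0 ≤ ε) :
    ∫ ζ : Circle, ‖(ζ : ℂ) - 1‖ ∂μ ≤ ε + 2 * μ.real {ζ : Circle | ε ≤ ‖(ζ : ℂ) - 1‖} := by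
  have hmeas : MeasurableSet {ζ : Circle | ε ≤ ‖(ζ : ℂ) - 1‖} :=
    (isClosed_le continuous_const (by fun_prop)).measurableSet
  have hind : Integrable ({ζ : Circle | ε ≤ ‖(ζ : ℂ) - 1‖}.indicator fun _ => (2 : ℝ)) μ :=
    (integrable_const _).indicator hmeas
  have heq : ∫ ζ : Circle, (ε + {ζ : Circle | ε ≤ ‖(ζ : ℂ) - 1‖}.indicator (fun _ => (2 : ℝ)) ζ) ∂μ
      = ε + 2 * μ.real {ζ : Circle | ε ≤ ‖(ζ : ℂ) - 1‖} := by
    rw [integral_add (integrable_const _) hind, integral_indicator_const _ hmeas]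
    simp [mul_comm]
  rw [← heq]
  refine integral_mono
    (integrable_of_continuous_circle μ (g := fun ζ => (ζ : ℂ) - 1) (by fun_prop)).norm
    ((integrable_const _).add hind) fun ζ => ?_
  by_cases h : ε ≤ ‖(ζ : ℂ) - 1‖
  · have h2 : ‖(ζ : ℂ) - 1‖ ≤ 2 := (norm_sub_le _ _).trans (by rw [Circle.norm_coe, norm_one]; norm_num)
    simp only [Set.indicator, Set.mem_ofPred_eq, h, if_true]
    linarith
  · simp only [Set.indicator, Set.mem_ofPred_eq, h, if_false]
    linarith

theorem BT_ne_zero_of_integral_norm_lt (μ : Measure Circle) [IsProbabilityMeasure μ] {z : ℂ}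
    (hz : z ∈ ball (0 : ℂ) 1) (h : ∫ ζ : Circle, ‖(ζ : ℂ) - 1‖ ∂μ < 1 - ‖z‖) : BT μ z ≠ 0 := by
  rw [BT_eq_div μ hz]
  refine div_ne_zero (fun hzero => ?_) (integral_inv_one_sub_circle_mul_ne_zero μ hz)
  have hpos : 0 < 1 - ‖z‖ := sub_pos.2 (mem_ball_zero_iff.1 hz)
  have hint := integrable_of_continuous_circle μ
    (continuous_div_one_sub_circle_mul (g := fun ζ => (ζ : ℂ)) (by fun_prop) hz)
  have hone : ∫ ζ : Circle, ((ζ : ℂ) - 1) / (1 - (ζ : ℂ) * z) ∂μ = -1 := by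
    have heq : ∀ ζ : Circle, ((ζ : ℂ) - 1) / (1 - (ζ : ℂ) * z) =
        (1 - z) * ((ζ : ℂ) / (1 - (ζ : ℂ) * z)) - 1 := fun ζ => by
      have hne := one_sub_circle_mul_ne_zero ζ hz
      field_simp
      ring
    simp_rw [heq]
    rw [integral_sub (hint.const_mul _) (integrable_const _), integral_const_mul, hzero]
    simp
  have hle : ‖∫ ζ : Circle, ((ζ : ℂ) - 1) / (1 - (ζ : ℂ) * z) ∂μ‖ ≤
      ∫ ζ : Circle, ‖(ζ : ℂ) - 1‖ / (1 - ‖z‖) ∂μ := by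
    refine norm_integral_le_of_norm_le ((integrable_of_continuous_circle μ
      (g := fun ζ => (ζ : ℂ) - 1) (by fun_prop)).norm.div_const _)
      (Eventually.of_forall fun ζ => ?_)
    rw [norm_div]
    gcongr
    exact one_sub_norm_le_norm_one_sub_circle_mul ζ z
  rw [hone, norm_neg, norm_one, integral_div, le_div_iff₀ hpos] at hle
  linarith

theorem IsInfinitesimalArrayT.eventually_BT_ne_zero {kn : ℕ → ℕ} {μ : ℕ → ℕ → Measure Circle}
    (hinf : IsInfinitesimalArrayT kn μ) (hprob : ∀ n i, IsProbabilityMeasure (μ n i))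
    {r : ℝ} (hr : r < 1) :
    ∀ᶠ n in atTop, ∀ i < kn n, ∀ z ∈ closedBall (0 : ℂ) r, BT (μ n i) z ≠ 0 := by
  have hpos : 0 < (1 - r) / 4 := by linarith
  obtain ⟨N, hN⟩ := hinf ((1 - r) / 4) hpos (ENNReal.ofReal ((1 - r) / 4))
    (ENNReal.ofReal_pos.2 hpos)
  filter_upwards [eventually_ge_atTop N] with n hn i hi z hz
  have hp := hprob n i
  rw [mem_closedBall_zero_iff] at hz
  have hreal := ENNReal.toReal_lt_of_lt_ofReal (hN n hn i hi)
  have hle := integral_norm_circle_sub_one_le (μ n i) _ hpos.le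
  rw [Measure.real] at hle
  exact BT_ne_zero_of_integral_norm_lt _ (mem_ball_zero_iff.2 (hz.trans_lt hr)) (by linarith)

/-- Theorem 3.4 (boolean Hinčin): if the boolean convolutions
δ_{λ_n} ⨃ μ_{n1} ⨃ ⋯ ⨃ μ_{nk_n} (with B-transform λ_n·Π_k B_{μ_{nk}})
converge weakly to ν, then ν is ⨃-infinitely divisible, i.e. B_ν is
identically zero or nonvanishing on 𝔻. -/
theorem stmt4
    (τ : ℝ) (hτ : 0 < τ ∧ τ < Real.pi)
    (kn : ℕ → ℕ) (μ : ℕ → ℕ → Measure Circle)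
    (hprob : ∀ n i, IsProbabilityMeasure (μ n i))
    (hinf : IsInfinitesimalArrayT kn μ)
    (hmom : ∀ n : ℕ, ∀ i < kn n, (∫ ζ : Circle, (ζ : ℂ) ∂(μ n i)) ≠ 0)
    (lam : ℕ → Circle)
    (ν : Measure Circle) (hν : IsProbabilityMeasure ν)
    (hconv : ∀ K : Set ℂ, K ⊆ ball (0:ℂ) 1 → IsCompact K →
      TendstoUniformlyOn
        (fun n z => ((lam n : ℂ)) * ∏ i ∈ Finset.range (kn n), BT (μ n i) z)
        (BT ν) atTop K) :
    (∀ z ∈ ball (0:ℂ) 1, BT ν z = 0) ∨ (∀ z ∈ ball (0:ℂ) 1, BT ν z ≠ 0) := by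
  refine hurwitz_eqOn_zero_or_forall_ne_zero isOpen_ball (convex_ball _ _).isPreconnected
    (fun n => ?_) (fun K hK hKc => ?_) hconv
  · exact (DifferentiableOn.fun_finsetProd fun i _ => differentiableOn_BT (μ n i)).const_mul _
  · obtain ⟨r, hr, hKr⟩ := exists_lt_subset_ball hKc.isClosed hK
    filter_upwards [hinf.eventually_BT_ne_zero hprob hr] with n hn z hz
    exact mul_ne_zero (Circle.coe_ne_zero _) <| Finset.prod_ne_zero_iff.2 fun i hi =>
      hn i (Finset.mem_range.1 hi) z (ball_subset_closedBall (hKr hz))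

end
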